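/- Let A, B, C ∈ ℝ^{n×n}, let k ≥ 1 and set m = 2^k. Define the Cyclic Reduction iterates A_0 = A, B_0 = B̂_0 = B̃_0 = B, C_0 = C, and for j < k: A_{j+1} = A_j·B_j⁻¹·A_j, B_{j+1} = B_j − A_j·B_j⁻¹·C_j − C_j·B_j⁻¹·A_j, C_{j+1} = C_j·B_j⁻¹·C_j, B̂_{j+1} = B̂_j − C_j·B_j⁻¹·A_j, B̃_{j+1} = B̃_j − A_j·B_j⁻¹·C_j, assuming each B_j (j < k) is invertible. Let T be the (m+1)n × (m+1)n block tridiagonal matrix with n×n blocks: T_{0,0} = A + I − B, T_{r,r} = I − B for 1 ≤ r ≤ m−1, T_{m,m} = I − B + C, T_{r,r−1} = A for 1 ≤ r ≤ m, T_{r−1,r} = C for 1 ≤ r ≤ m, and all other blocks zero. Let b = {0, m} be the boundary block indices and i = {1, …, m−1} the interior block indices, and assume the (m−1)n × (m−1)n matrix I − T_{ii} (block tridiagonal with diagonal blocks B, subdiagonal blocks −A, superdiagonal blocks −C) is invertible. Then the censored matrix T_{bb} + T_{bi}·(I − T_{ii})⁻¹·T_{ib} equals the 2×2 block matrix [[A +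 I − B̂_k, C_k],[A_k, I − B̃_k + C]]. -/

import Mathlib

open Matrix

/-- One step of Cyclic Reduction on the 5-tuple `(A, B, C, B̂, B̃)`. -/
noncomputable def crStep5 {n : ℕ}
    (T : Matrix (Fin n) (Fin n) ℝ × Matrix (Fin n) (Fin n) ℝ × Matrix (Fin n) (Fin n) ℝ ×
      Matrix (Fin n) (Fin n) ℝ × Matrix (Fin n) (Fin n) ℝ) :
    Matrix (Fin n) (Fin n) ℝ × Matrix (Fin n) (Fin n) ℝ × Matrix (Fin n) (Fin n) ℝ ×
      Matrix (Fin n) (Fin n) ℝ × Matrix (Fin n) (Fin n) ℝ :=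
  (T.1 * T.2.1⁻¹ * T.1,
   T.2.1 - T.1 * T.2.1⁻¹ * T.2.2.1 - T.2.2.1 * T.2.1⁻¹ * T.1,
   T.2.2.1 * T.2.1⁻¹ * T.2.2.1,
   T.2.2.2.1 - T.2.2.1 * T.2.1⁻¹ * T.1,
   T.2.2.2.2 - T.1 * T.2.1⁻¹ * T.2.2.1)

/-- The `k`-th Cyclic Reduction iterate `(A_k, B_k, C_k, B̂_k, B̃_k)`, starting from
`(A, B, C, B, B)`. -/
noncomputable def crIter5 {n : ℕ} (A B C : Matrix (Fin n) (Fin n) ℝ) (k : ℕ) :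
    Matrix (Fin n) (Fin n) ℝ × Matrix (Fin n) (Fin n) ℝ × Matrix (Fin n) (Fin n) ℝ ×
      Matrix (Fin n) (Fin n) ℝ × Matrix (Fin n) (Fin n) ℝ :=
  crStep5^[k] (A, B, C, B, B)

/-- The `(m+1)n × (m+1)n` block tridiagonal matrix with diagonal blocks
`A + I − B, I − B, …, I − B, I − B + C`, subdiagonal blocks `A` and superdiagonal blocks
`C`. -/
def censT {n : ℕ} (A B C : Matrix (Fin n) (Fin n) ℝ) (m : ℕ) :
    Matrix (Fin (m + 1) × Fin n) (Fin (m + 1) × Fin n) ℝ :=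
  fun x y =>
    if x.1 = y.1 then
      (if (x.1 : ℕ) = 0 then A + 1 - B else if (x.1 : ℕ) = m then 1 - B + C else 1 - B) x.2 y.2
    else if (y.1 : ℕ) = (x.1 : ℕ) + 1 then C x.2 y.2
    else if (x.1 : ℕ) = (y.1 : ℕ) + 1 then A x.2 y.2
    else 0

/-- The embedding of the boundary block indices `{0, m}`. -/
def bEmb (m n : ℕ) : Fin 2 × Fin n → Fin (m + 1) × Fin n :=
  fun x => (if x.1 = 0 then (⟨0, Nat.succ_pos m⟩ : Fin (m + 1)) else Fin.last m, x.2)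

/-- The embedding of the interior block indices `{1, …, m−1}`. -/
def iEmb (m n : ℕ) : Fin (m - 1) × Fin n → Fin (m + 1) × Fin n :=
  fun x => (⟨x.1.1 + 1, by have := x.1.isLt; omega⟩, x.2)

lemma mat_ext_vec {ι κ : Type*} [Fintype κ] [DecidableEq κ] (M N : Matrix ι κ ℝ)
    (h : ∀ v, M *ᵥ v = N *ᵥ v) : M = N := by
  refine Matrix.toLin'.injective (LinearMap.ext fun v => ?_)
  rw [toLin'_apply, toLin'_apply, h]

lemma cr_aux {n : ℕ} (k : ℕ) :
    ∀ (t : Matrix (Fin n) (Fin n) ℝ × Matrix (Fin n) (Fin n) ℝ × Matrix (Fin n) (Fin n) ℝ ×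
      Matrix (Fin n) (Fin n) ℝ × Matrix (Fin n) (Fin n) ℝ) (w : ℕ → Fin n → ℝ)
    (_ : ∀ j < k, IsUnit ((crStep5^[j] t).2.1).det)
    (_ : ∀ q, q + 1 < 2 ^ k → t.2.1 *ᵥ w (q + 1) = t.1 *ᵥ w q + t.2.2.1 *ᵥ w (q + 2)),
    (crStep5^[k] t).2.2.2.1 *ᵥ w 0 - (crStep5^[k] t).2.2.1 *ᵥ w (2 ^ k)
        = t.2.2.2.1 *ᵥ w 0 - t.2.2.1 *ᵥ w 1 ∧
    (crStep5^[k] t).2.2.2.2 *ᵥ w (2 ^ k) - (crStep5^[k] t).1 *ᵥ w 0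
        = t.2.2.2.2 *ᵥ w (2 ^ k) - t.1 *ᵥ w (2 ^ k - 1) := by
  induction k with
  | zero => intro t w _ _; simp
  | succ k ih =>
    intro t w hinv h
    have hB : IsUnit t.2.1.det := hinv 0 (Nat.succ_pos k)
    have hpos : 0 < 2 ^ k := by positivity
    have hpow : 2 ^ (k + 1) = 2 * 2 ^ k := by ring
    have hs : ∀ q, q + 1 < 2 ^ (k + 1) →
        w (q + 1) = t.2.1⁻¹ *ᵥ (t.1 *ᵥ w q) + t.2.1⁻¹ *ᵥ (t.2.2.1 *ᵥ w (q + 2)) := by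
      intro q hq
      rw [← mulVec_add, ← h q hq, mulVec_mulVec, nonsing_inv_mul _ hB, one_mulVec]
    have key := ih (crStep5 t) (fun q => w (2 * q))
      (fun j hj => by
        have := hinv (j + 1) (by omega)
        rwa [Function.iterate_succ_apply] at this)
      (fun q hq => by
        have h0 := hs (2 * q) (by omega)
        have h1 := h (2 * q + 1) (by omega)
        have h2 := hs (2 * q + 2) (by omega)
        have e1 : 2 * (q + 1) = 2 * q + 2 := by ring
        have e2 : 2 * (q + 2) = 2 * q + 4 := by ring
        simp only [e1, e2]
        simp only [crStep5, sub_mulVec, ← mulVec_mulVec]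
        rw [show 2 * q + 1 + 1 = 2 * q + 2 from rfl, show 2 * q + 1 + 2 = 2 * q + 2 + 1 from rfl,
          h0, h2] at h1
        rw [h1]
        simp only [mulVec_add]
        abel)
    rw [Function.iterate_succ_apply]
    rw [← hpow] at key
    obtain ⟨k1, k2⟩ := key
    refine ⟨k1.trans ?_, k2.trans ?_⟩
    · have h0 := hs 0 (by omega)
      simp only [Nat.zero_add] at h0
      rw [h0]
      simp only [crStep5, sub_mulVec, ← mulVec_mulVec, mulVec_add, mul_zero, mul_one]
      abel
    · have h0 := hs (2 ^ (k + 1) - 2) (by omega)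
      rw [show 2 ^ (k + 1) - 2 + 1 = 2 ^ (k + 1) - 1 by omega,
        show 2 ^ (k + 1) - 2 + 2 = 2 ^ (k + 1) by omega] at h0
      rw [h0, show 2 * (2 ^ k - 1) = 2 ^ (k + 1) - 2 by omega]
      simp only [crStep5, sub_mulVec, ← mulVec_mulVec, mulVec_add]
      abel

lemma censT_row {n : ℕ} (A B C : Matrix (Fin n) (Fin n) ℝ) (m : ℕ) (u : ℕ → Fin n → ℝ)
    (r : Fin (m + 1)) (a : Fin n) :
    (censT A B C m *ᵥ (fun x => u x.1 x.2)) (r, a) =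
      ((if (r : ℕ) = 0 then A + 1 - B else if (r : ℕ) = m then 1 - B + C else 1 - B) *ᵥ u r) a
      + (if (r : ℕ) + 1 ≤ m then (C *ᵥ u (r + 1)) a else 0)
      + (if 1 ≤ (r : ℕ) then (A *ᵥ u (r - 1)) a else 0) := by
  set D := (if (r : ℕ) = 0 then A + 1 - B else if (r : ℕ) = m then 1 - B + C else 1 - B) with hD
  have h1 : (censT A B C m *ᵥ (fun x => u x.1 x.2)) (r, a) =
      ∑ s : Fin (m + 1), (fun s : ℕ => (if (r : ℕ) = s then (D *ᵥ u s) a else 0)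
        + (if (r : ℕ) + 1 = s then (C *ᵥ u s) a else 0)
        + (if (r : ℕ) = s + 1 then (A *ᵥ u s) a else 0)) s := by
    simp only [mulVec, dotProduct]
    rw [Fintype.sum_prod_type]
    refine Finset.sum_congr rfl fun s _ => ?_
    simp only [censT, ← hD, Fin.ext_iff]
    split_ifs <;> first | omega | simp
  rw [h1, Fin.sum_univ_eq_sum_range (fun s : ℕ => (if (r : ℕ) = s then (D *ᵥ u s) a else 0)
        + (if (r : ℕ) + 1 = s then (C *ᵥ u s) a else 0)
        + (if (r : ℕ) = s + 1 then (A *ᵥ u s) a else 0)), Finset.sum_add_distrib, Finset.sum_add_distrib,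
    Finset.sum_ite_eq, Finset.sum_ite_eq]
  have hr := r.isLt
  congr 1
  · congr 1
    · simp [hr]
    · simp [Nat.lt_succ_iff]
  · split_ifs with h
    · rw [Finset.sum_eq_single ((r : ℕ) - 1)]
      · rw [if_pos (by omega)]
      · intro b _ hb
        rw [if_neg (by omega)]
      · intro hb
        simp only [Finset.mem_range] at hb
        omega
    · exact Finset.sum_eq_zero fun s _ => by rw [if_neg (by omega)]

lemma split_row {n m : ℕ} (hm : 1 ≤ m) (T : Matrix (Fin (m + 1) × Fin n) (Fin (m + 1) × Fin n) ℝ)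
    (U : Fin (m + 1) × Fin n → ℝ) {ι : Type*} (f : ι → Fin (m + 1) × Fin n) (x : ι) :
    (T.submatrix f (bEmb m n) *ᵥ (U ∘ bEmb m n)) x + (T.submatrix f (iEmb m n) *ᵥ (U ∘ iEmb m n)) x
      = (T *ᵥ U) (f x) := by
  obtain ⟨m, rfl⟩ : ∃ m', m = m' + 1 := ⟨m - 1, by omega⟩
  simp only [mulVec, dotProduct, Fintype.sum_prod_type]
  rw [Fin.sum_univ_succ (n := m + 1), Fin.sum_univ_castSucc (n := m), Fin.sum_univ_two]
  simp only [submatrix_apply, Function.comp, bEmb, iEmb]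
  have : ∀ a b c d e : ℝ, a = d → b = e → a + b + c = d + (c + e) := by
    intros; subst_vars; ring
  exact this _ _ _ _ _ rfl rfl

/-- The iterates of Cyclic Reduction (including the auxiliary sequences `B̂_k`, `B̃_k`) are
the result of censoring a block tridiagonal matrix onto its first and last block indices. -/
theorem cyclic_reduction_as_censoring {n : ℕ} (A B C : Matrix (Fin n) (Fin n) ℝ)
    (k : ℕ) (hk : 1 ≤ k) (m : ℕ) (hm : m = 2 ^ k)
    (hBinv : ∀ j < k, IsUnit ((crIter5 A B C j).2.1).det)
    (hTinv : IsUnit ((1 : Matrix (Fin (m - 1) × Fin n) (Fin (m - 1) × Fin n) ℝ) -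
      (censT A B C m).submatrix (iEmb m n) (iEmb m n)).det) :
    (censT A B C m).submatrix (bEmb m n) (bEmb m n) +
        (censT A B C m).submatrix (bEmb m n) (iEmb m n) *
          ((1 : Matrix (Fin (m - 1) × Fin n) (Fin (m - 1) × Fin n) ℝ) -
            (censT A B C m).submatrix (iEmb m n) (iEmb m n))⁻¹ *
          (censT A B C m).submatrix (iEmb m n) (bEmb m n) =
      fun x y =>
        if x.1 = 0 then
          (if y.1 = 0 then (A + 1 - (crIter5 A B C k).2.2.2.1) x.2 y.2
           else ((crIter5 A B C k).2.2.1) x.2 y.2)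
        else
          (if y.1 = 0 then ((crIter5 A B C k).1) x.2 y.2
           else ((1 : Matrix (Fin n) (Fin n) ℝ) - (crIter5 A B C k).2.2.2.2 + C) x.2 y.2) := by
  have hm1 : 1 ≤ m := by rw [hm]; exact Nat.one_le_two_pow
  have hm2 : 2 ≤ m := by rw [hm]; exact Nat.le_self_pow (by omega) 2
  refine mat_ext_vec _ _ fun v => ?_
  set T := censT A B C m with hT
  set M := (1 : Matrix (Fin (m - 1) × Fin n) (Fin (m - 1) × Fin n) ℝ) -
      T.submatrix (iEmb m n) (iEmb m n) with hM
  set z := M⁻¹ *ᵥ (T.submatrix (iEmb m n) (bEmb m n) *ᵥ v) with hz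
  have hMz : M *ᵥ z = T.submatrix (iEmb m n) (bEmb m n) *ᵥ v := by
    rw [hz, mulVec_mulVec, mul_nonsing_inv _ hTinv, one_mulVec]
  let u : ℕ → Fin n → ℝ := fun r a => if r = 0 then v (0, a) else
    if h : r - 1 < m - 1 then z (⟨r - 1, h⟩, a) else v (1, a)
  let U : Fin (m + 1) × Fin n → ℝ := fun x => u x.1 x.2
  have hUb : U ∘ bEmb m n = v := by
    funext ⟨s, a⟩
    fin_cases s
    · simp [U, u, bEmb]
    · simp [U, u, bEmb, show m ≠ 0 by omega]
  have hUi : U ∘ iEmb m n = z := by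
    funext ⟨s, a⟩
    simp [U, u, iEmb]
  have hrow : ∀ q, q + 1 < 2 ^ k → B *ᵥ u (q + 1) = A *ᵥ u q + C *ᵥ u (q + 2) := by
    intro q hq
    rw [← hm] at hq
    funext a
    have h1 := split_row hm1 T U (iEmb m n) (⟨q, by omega⟩, a)
    rw [hUb, hUi, ← hMz, hM, sub_mulVec, one_mulVec, Pi.sub_apply, sub_add_cancel] at h1
    have h2 := censT_row A B C m u ⟨q + 1, by omega⟩ a
    have h3 : z (⟨q, by omega⟩, a) = u (q + 1) a := by
      simp [u, show q < m - 1 by omega]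
    rw [h3] at h1
    have h4 := h1.trans h2
    simp only [Nat.add_eq_zero_iff, one_ne_zero, and_false, if_false, show q + 1 ≠ m by omega,
      if_pos (show q + 1 + 1 ≤ m by omega), if_pos (show 1 ≤ q + 1 by omega),
      Nat.add_sub_cancel, sub_mulVec, one_mulVec, Pi.sub_apply] at h4
    rw [Pi.add_apply]
    change _ = _ - _ + (C *ᵥ u (q + 2)) a + _ at h4
    linarith
  obtain ⟨r1, r2⟩ := cr_aux k (A, B, C, B, B) u hBinv hrow
  rw [← hm] at r1 r2
  change (crIter5 A B C k).2.2.2.1 *ᵥ u 0 - (crIter5 A B C k).2.2.1 *ᵥ u m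
    = B *ᵥ u 0 - C *ᵥ u 1 at r1
  change (crIter5 A B C k).2.2.2.2 *ᵥ u m - (crIter5 A B C k).1 *ᵥ u 0
    = B *ᵥ u m - A *ᵥ u (m - 1) at r2
  rw [add_mulVec, ← mulVec_mulVec, ← mulVec_mulVec, ← hz]
  have hu0 : ∀ a, v (0, a) = u 0 a := fun a => by simp [u]
  have hum : ∀ a, v (1, a) = u m a := fun a => by simp [u, show m ≠ 0 by omega]
  funext ⟨s, a⟩
  have hs := split_row hm1 T U (bEmb m n) (s, a)
  rw [hUb, hUi] at hs
  rw [Pi.add_apply, hs]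
  have r1a := congrFun r1 a
  have r2a := congrFun r2 a
  simp only [Pi.sub_apply] at r1a r2a
  fin_cases s
  · have h2 := censT_row A B C m u ⟨0, by omega⟩ a
    refine h2.trans ?_
    trans ((A + 1 - (crIter5 A B C k).2.2.2.1) *ᵥ u 0) a + ((crIter5 A B C k).2.2.1 *ᵥ u m) a
    · simp only [if_true, zero_add, if_pos hm1, add_mulVec, sub_mulVec, Pi.add_apply,
        Pi.sub_apply, show ¬ (1 ≤ 0) by omega, if_false]
      linarith
    · simp only [mulVec, dotProduct, Fintype.sum_prod_type, Fin.sum_univ_two]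
      simp [hu0, hum]
  · have h2 := censT_row A B C m u (Fin.last m) a
    refine h2.trans ?_
    trans ((crIter5 A B C k).1 *ᵥ u 0) a + ((1 - (crIter5 A B C k).2.2.2.2 + C) *ᵥ u m) a
    · simp only [Fin.val_last, if_neg (show m ≠ 0 by omega), if_true, if_pos hm1,
        add_mulVec, sub_mulVec, Pi.add_apply,
        Pi.sub_apply, show ¬ (m + 1 ≤ m) by omega, if_false]
      linarith
    · simp only [mulVec, dotProduct, Fintype.sum_prod_type, Fin.sum_univ_two]
      simp [hu0, hum]
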